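/- Let a, b ∈ ℝ and let m ≥ 1 be an integer. There exists a constant c > 0, depending only on a, b and m, such that for every smooth periodic function u : ℝ² → ℝ, ‖A^{m−1} f(u)‖ ≤ c(‖A^m u‖ + ‖A^m u‖² + ‖A^m u‖³), where f(u) = (a+3)u − 4Au + b|∇u|² + u³. -/

import Mathlib

open MeasureTheory Real Filter

noncomputable section

/-- A function `u : ℝ² → ℝ` is smooth periodic if it is `C^∞` and `2π`-periodic
in each variable. -/
def SmoothPeriodic (u : ℝ × ℝ → ℝ) : Prop :=
  ContDiff ℝ (⊤ : ℕ∞) u ∧ (∀ x y, u (x + 2 * Real.pi, y) = u (x, y)) ∧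
    (∀ x y, u (x, y + 2 * Real.pi) = u (x, y))

/-- Partial derivative in the first variable. -/
def pdx (u : ℝ × ℝ → ℝ) : ℝ × ℝ → ℝ := fun p => fderiv ℝ u p (1, 0)

/-- Partial derivative in the second variable. -/
def pdy (u : ℝ × ℝ → ℝ) : ℝ × ℝ → ℝ := fun p => fderiv ℝ u p (0, 1)

/-- The fundamental domain `[0, 2π]²`. -/
def sq2 : Set (ℝ × ℝ) := Set.Icc (0 : ℝ) (2 * Real.pi) ×ˢ Set.Icc (0 : ℝ) (2 * Real.pi)

/-- The `L²` inner product over `[0, 2π]²`. -/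
def l2inner (u v : ℝ × ℝ → ℝ) : ℝ := ∫ p in sq2, u p * v p

/-- The `L²` norm over `[0, 2π]²`. -/
def l2norm (u : ℝ × ℝ → ℝ) : ℝ := Real.sqrt (∫ p in sq2, (u p) ^ 2)

/-- The `L^q` norm over `[0, 2π]²`. -/
def lpnorm (q : ℝ) (u : ℝ × ℝ → ℝ) : ℝ := (∫ p in sq2, |u p| ^ q) ^ (1 / q)

/-- The operator `A = -Δ + 1`. -/
def Aop (u : ℝ × ℝ → ℝ) : ℝ × ℝ → ℝ :=
  fun p => -(pdx (pdx u) p + pdy (pdy u) p) + u p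

/-- The pointwise dot product of gradients, `∇v ⋅ ∇w`. -/
def gradDot (v w : ℝ × ℝ → ℝ) : ℝ × ℝ → ℝ :=
  fun p => pdx v p * pdx w p + pdy v p * pdy w p

/-- The nonlinearity `f(u) = (a+3)u − 4Au + b|∇u|² + u³`. -/
def fNL (a b : ℝ) (u : ℝ × ℝ → ℝ) : ℝ × ℝ → ℝ :=
  fun p => (a + 3) * u p - 4 * Aop u p + b * gradDot u u p + (u p) ^ 3

section

namespace SmoothPeriodic

variable {u v w : ℝ × ℝ → ℝ}

theorem differentiable (hu : SmoothPeriodic u) : Differentiable ℝ u :=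
  hu.1.differentiable (by simp)

theorem continuous (hu : SmoothPeriodic u) : Continuous u := hu.1.continuous

theorem contDiff_fderiv_apply (hu : SmoothPeriodic u) (e : ℝ × ℝ) :
    ContDiff ℝ (⊤ : ℕ∞) fun p => fderiv ℝ u p e :=
  (hu.1.fderiv_right (m := (⊤ : ℕ∞)) (by simp)).clm_apply contDiff_const

theorem fderiv_add_fst (hu : SmoothPeriodic u) (x y : ℝ) :
    fderiv ℝ u (x + 2 * Real.pi, y) = fderiv ℝ u (x, y) := by
  have h : (fun p : ℝ × ℝ => u (p + (2 * Real.pi, 0))) = u := by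
    ext ⟨x, y⟩
    simpa using hu.2.1 x y
  have h2 := fderiv_comp_add_right (𝕜 := ℝ) (f := u) (x := (x, y)) (2 * Real.pi, 0)
  rw [h] at h2
  simpa using h2.symm

theorem fderiv_add_snd (hu : SmoothPeriodic u) (x y : ℝ) :
    fderiv ℝ u (x, y + 2 * Real.pi) = fderiv ℝ u (x, y) := by
  have h : (fun p : ℝ × ℝ => u (p + (0, 2 * Real.pi))) = u := by
    ext ⟨x, y⟩
    simpa using hu.2.2 x y
  have h2 := fderiv_comp_add_right (𝕜 := ℝ) (f := u) (x := (x, y)) (0, 2 * Real.pi)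
  rw [h] at h2
  simpa using h2.symm

theorem pdx (hu : SmoothPeriodic u) : SmoothPeriodic (pdx u) :=
  ⟨hu.contDiff_fderiv_apply _, fun x y => by simp [_root_.pdx, hu.fderiv_add_fst],
    fun x y => by simp [_root_.pdx, hu.fderiv_add_snd]⟩

theorem pdy (hu : SmoothPeriodic u) : SmoothPeriodic (pdy u) :=
  ⟨hu.contDiff_fderiv_apply _, fun x y => by simp [_root_.pdy, hu.fderiv_add_fst],
    fun x y => by simp [_root_.pdy, hu.fderiv_add_snd]⟩

theorem add (hu : SmoothPeriodic u) (hv : SmoothPeriodic v) :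
    SmoothPeriodic fun p => u p + v p :=
  ⟨hu.1.add hv.1, fun x y => by simp only [hu.2.1, hv.2.1],
    fun x y => by simp only [hu.2.2, hv.2.2]⟩

theorem const_mul (hu : SmoothPeriodic u) (a : ℝ) : SmoothPeriodic fun p => a * u p :=
  ⟨contDiff_const.mul hu.1, fun x y => by simp only [hu.2.1],
    fun x y => by simp only [hu.2.2]⟩

theorem mul (hu : SmoothPeriodic u) (hv : SmoothPeriodic v) :
    SmoothPeriodic fun p => u p * v p :=
  ⟨hu.1.mul hv.1, fun x y => by simp only [hu.2.1, hv.2.1],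
    fun x y => by simp only [hu.2.2, hv.2.2]⟩

theorem Aop (hu : SmoothPeriodic u) : SmoothPeriodic (Aop u) := by
  have h := ((hu.pdx.pdx.add hu.pdy.pdy).const_mul (-1)).add hu
  have e : _root_.Aop u = fun p => -1 * (_root_.pdx (_root_.pdx u) p +
      _root_.pdy (_root_.pdy u) p) + u p := by
    ext p
    simp [_root_.Aop]
  rwa [e]

end SmoothPeriodic

variable {u v w : ℝ × ℝ → ℝ}

theorem pdx_add (hu : SmoothPeriodic u) (hv : SmoothPeriodic v) :
    pdx (fun p => u p + v p) = fun p => pdx u p + pdx v p := by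
  ext p
  simp [pdx, fderiv_fun_add (hu.differentiable p) (hv.differentiable p)]

theorem pdy_add (hu : SmoothPeriodic u) (hv : SmoothPeriodic v) :
    pdy (fun p => u p + v p) = fun p => pdy u p + pdy v p := by
  ext p
  simp [pdy, fderiv_fun_add (hu.differentiable p) (hv.differentiable p)]

theorem pdx_const_mul (hu : SmoothPeriodic u) (a : ℝ) :
    pdx (fun p => a * u p) = fun p => a * pdx u p := by
  ext p
  simp [pdx, fderiv_const_mul (hu.differentiable p)]

theorem pdy_const_mul (hu : SmoothPeriodic u) (a : ℝ) :
    pdy (fun p => a * u p) = fun p => a * pdy u p := by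
  ext p
  simp [pdy, fderiv_const_mul (hu.differentiable p)]

theorem pdx_mul (hu : SmoothPeriodic u) (hv : SmoothPeriodic v) :
    pdx (fun p => u p * v p) = fun p => pdx u p * v p + u p * pdx v p := by
  ext p
  simp [pdx, fderiv_fun_mul (hu.differentiable p) (hv.differentiable p)]
  ring

theorem pdy_mul (hu : SmoothPeriodic u) (hv : SmoothPeriodic v) :
    pdy (fun p => u p * v p) = fun p => pdy u p * v p + u p * pdy v p := by
  ext p
  simp [pdy, fderiv_fun_mul (hu.differentiable p) (hv.differentiable p)]
  ring

theorem pdx_pdy_comm (hu : SmoothPeriodic u) : pdx (pdy u) = pdy (pdx u) := by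
  have hd : Differentiable ℝ (fderiv ℝ u) :=
    (hu.1.fderiv_right (m := (⊤ : ℕ∞)) (by simp)).differentiable (by simp)
  have key : ∀ (p e d : ℝ × ℝ),
      fderiv ℝ (fun q => fderiv ℝ u q e) p d = fderiv ℝ (fderiv ℝ u) p d e := by
    intro p e d
    rw [fderiv_clm_apply (hd p) (differentiableAt_const e)]
    simp
  ext p
  have hs : IsSymmSndFDerivAt ℝ u p :=
    hu.1.contDiffAt.isSymmSndFDerivAt
      (by rw [minSmoothness_of_isRCLikeNormedField]; exact WithTop.coe_le_coe.2 le_top)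
  exact (key p _ _).trans ((hs _ _).trans (key p _ _).symm)

theorem pdx_Aop (hu : SmoothPeriodic u) : pdx (Aop u) = Aop (pdx u) := by
  have e : Aop u = fun p => -1 * (pdx (pdx u) p + pdy (pdy u) p) + u p := by
    ext p
    simp [Aop]
  rw [e, pdx_add ((hu.pdx.pdx.add hu.pdy.pdy).const_mul (-1)) hu,
    pdx_const_mul (hu.pdx.pdx.add hu.pdy.pdy), pdx_add hu.pdx.pdx hu.pdy.pdy,
    pdx_pdy_comm hu.pdy, pdx_pdy_comm hu]
  ext p
  simp [Aop]

theorem pdy_Aop (hu : SmoothPeriodic u) : pdy (Aop u) = Aop (pdy u) := by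
  have e : Aop u = fun p => -1 * (pdx (pdx u) p + pdy (pdy u) p) + u p := by
    ext p
    simp [Aop]
  rw [e, pdy_add ((hu.pdx.pdx.add hu.pdy.pdy).const_mul (-1)) hu,
    pdy_const_mul (hu.pdx.pdx.add hu.pdy.pdy), pdy_add hu.pdx.pdx hu.pdy.pdy,
    ← pdx_pdy_comm hu.pdx, ← pdx_pdy_comm hu]
  ext p
  simp [Aop]

theorem isCompact_sq2 : IsCompact sq2 := isCompact_Icc.prod isCompact_Icc

theorem Continuous.integrableOn_sq2 (hu : Continuous u) : IntegrableOn u sq2 :=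
  hu.continuousOn.integrableOn_compact isCompact_sq2

theorem setIntegral_sq2 (hu : Continuous u) :
    ∫ p in sq2, u p =
      ∫ x in Set.Icc 0 (2 * Real.pi), ∫ y in Set.Icc 0 (2 * Real.pi), u (x, y) :=
  setIntegral_prod u hu.integrableOn_sq2

theorem setIntegral_sq2_symm (hu : Continuous u) :
    ∫ p in sq2, u p =
      ∫ y in Set.Icc 0 (2 * Real.pi), ∫ x in Set.Icc 0 (2 * Real.pi), u (x, y) := by
  have h := setIntegral_sq2 (u := fun p => u p.swap) (hu.comp continuous_swap)
  simp only [Prod.swap_prod_mk] at h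
  rw [← h]
  exact (setIntegral_prod_swap (μ := volume) (ν := volume) _ _ u).symm

theorem hasDerivAt_fst (hu : SmoothPeriodic u) (x y : ℝ) :
    HasDerivAt (fun s => u (s, y)) (pdx u (x, y)) x :=
  (hu.differentiable (x, y)).hasFDerivAt.comp_hasDerivAt x
    ((hasDerivAt_id x).prodMk (hasDerivAt_const x y))

theorem hasDerivAt_snd (hu : SmoothPeriodic u) (x y : ℝ) :
    HasDerivAt (fun s => u (x, s)) (pdy u (x, y)) y :=
  (hu.differentiable (x, y)).hasFDerivAt.comp_hasDerivAt y
    ((hasDerivAt_const y x).prodMk (hasDerivAt_id y))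

theorem setIntegral_Icc_deriv_eq_sub {g g' : ℝ → ℝ} (hg : ∀ x, HasDerivAt g (g' x) x)
    (hg' : Continuous g') :
    ∫ x in Set.Icc 0 (2 * Real.pi), g' x = g (2 * Real.pi) - g 0 := by
  rw [integral_Icc_eq_integral_Ioc,
    ← intervalIntegral.integral_of_le (by positivity)]
  exact intervalIntegral.integral_eq_sub_of_hasDerivAt (fun x _ => hg x)
    (hg'.intervalIntegrable _ _)

theorem setIntegral_pdx (hu : SmoothPeriodic u) : ∫ p in sq2, pdx u p = 0 := by
  rw [setIntegral_sq2_symm hu.pdx.continuous]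
  have h : ∀ y, ∫ x in Set.Icc 0 (2 * Real.pi), pdx u (x, y) = 0 := fun y => by
    rw [setIntegral_Icc_deriv_eq_sub (fun x => hasDerivAt_fst hu x y)
      (hu.pdx.continuous.comp (by fun_prop))]
    have := hu.2.1 0 y
    simp_all
  simp [h]

theorem setIntegral_pdy (hu : SmoothPeriodic u) : ∫ p in sq2, pdy u p = 0 := by
  rw [setIntegral_sq2 hu.pdy.continuous]
  have h : ∀ x, ∫ y in Set.Icc 0 (2 * Real.pi), pdy u (x, y) = 0 := fun x => by
    rw [setIntegral_Icc_deriv_eq_sub (fun y => hasDerivAt_snd hu x y)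
      (hu.pdy.continuous.comp (by fun_prop))]
    have := hu.2.2 x 0
    simp_all
  simp [h]

theorem setIntegral_sq2_nonneg (u : ℝ × ℝ → ℝ) : 0 ≤ ∫ p in sq2, (u p) ^ 2 :=
  integral_nonneg fun _ => sq_nonneg _

theorem l2norm_nonneg (u : ℝ × ℝ → ℝ) : 0 ≤ l2norm u := Real.sqrt_nonneg _

theorem l2norm_le_iff {C : ℝ} : l2norm u ≤ C ↔ 0 ≤ C ∧ ∫ p in sq2, (u p) ^ 2 ≤ C ^ 2 :=
  Real.sqrt_le_iff

/-- The `L²` norm of `Au` in terms of the derivatives of `u` up to order two. -/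
theorem setIntegral_Aop_sq (hu : SmoothPeriodic u) :
    ∫ p in sq2, (Aop u p) ^ 2 =
      (∫ p in sq2, (u p) ^ 2) + 2 * (∫ p in sq2, (pdx u p) ^ 2) +
      2 * (∫ p in sq2, (pdy u p) ^ 2) + (∫ p in sq2, (pdx (pdx u) p) ^ 2) +
      2 * (∫ p in sq2, (pdy (pdx u) p) ^ 2) + (∫ p in sq2, (pdy (pdy u) p) ^ 2) := by
  have h1 := hu.mul hu.pdx
  have h2 := hu.mul hu.pdy
  have h3 := hu.pdx.mul hu.pdy.pdy
  have h4 := hu.pdx.mul hu.pdx.pdy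
  have e : ∀ p, (Aop u p) ^ 2 = (u p) ^ 2 + 2 * (pdx u p) ^ 2 + 2 * (pdy u p) ^ 2 +
      (pdx (pdx u) p) ^ 2 + 2 * (pdy (pdx u) p) ^ 2 + (pdy (pdy u) p) ^ 2 +
      (-2) * pdx (fun q => u q * pdx u q) p + (-2) * pdy (fun q => u q * pdy u q) p +
      2 * pdx (fun q => pdx u q * pdy (pdy u) q) p +
      (-2) * pdy (fun q => pdx u q * pdy (pdx u) q) p := by
    intro p
    rw [pdx_mul hu hu.pdx, pdy_mul hu hu.pdy, pdx_mul hu.pdx hu.pdy.pdy,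
      pdy_mul hu.pdx hu.pdx.pdy, pdx_pdy_comm hu.pdy, pdx_pdy_comm hu]
    simp only [Aop]
    ring
  have c0 := hu.continuous
  have c1 := hu.pdx.continuous
  have c2 := hu.pdy.continuous
  have c3 := hu.pdx.pdx.continuous
  have c4 := hu.pdx.pdy.continuous
  have c5 := hu.pdy.pdy.continuous
  have c6 := h1.pdx.continuous
  have c7 := h2.pdy.continuous
  have c8 := h3.pdx.continuous
  have c9 := h4.pdy.continuous
  simp_rw [e]
  repeat rw [integral_add (Continuous.integrableOn_sq2 (by fun_prop))
    (Continuous.integrableOn_sq2 (by fun_prop))]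
  simp only [integral_const_mul, setIntegral_pdx h1, setIntegral_pdy h2, setIntegral_pdx h3,
    setIntegral_pdy h4]
  ring

/-- A one-dimensional Sobolev inequality. -/
theorem sq_le_setIntegral_Icc {g g' : ℝ → ℝ} (hg : ∀ x, HasDerivAt g (g' x) x)
    (hg' : Continuous g') {x : ℝ} (hx : x ∈ Set.Icc 0 (2 * Real.pi)) :
    (g x) ^ 2 ≤ ∫ s in Set.Icc 0 (2 * Real.pi), (2 * (g s) ^ 2 + (g' s) ^ 2) := by
  have cg : Continuous g := continuous_iff_continuousAt.2 fun x => (hg x).continuousAt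
  have int : ∀ {h : ℝ → ℝ}, Continuous h → IntegrableOn h (Set.Icc 0 (2 * Real.pi)) :=
    fun h => h.continuousOn.integrableOn_compact isCompact_Icc
  set K := ∫ s in Set.Icc 0 (2 * Real.pi), ((g s) ^ 2 + (g' s) ^ 2) with hK
  have step : ∀ s ∈ Set.Icc 0 (2 * Real.pi), (g x) ^ 2 ≤ (g s) ^ 2 + K := by
    intro s hs
    have hd : ∀ t, HasDerivAt (fun t => (g t) ^ 2) (2 * g t * g' t) t := fun t => by
      simpa using (hg t).fun_pow 2
    have h1 : ∫ t in s..x, 2 * g t * g' t = (g x) ^ 2 - (g s) ^ 2 :=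
      intervalIntegral.integral_eq_sub_of_hasDerivAt (fun t _ => hd t)
        (Continuous.intervalIntegrable (by fun_prop) _ _)
    have h2 : ∫ t in s..x, 2 * g t * g' t ≤ K := by
      refine (le_abs_self _).trans ?_
      rw [← Real.norm_eq_abs]
      refine (intervalIntegral.norm_integral_le_integral_norm_uIoc).trans ?_
      have hsub : Set.uIoc s x ⊆ Set.Icc 0 (2 * Real.pi) :=
        Set.uIoc_subset_uIcc.trans (Set.uIcc_subset_Icc hs hx)
      calc ∫ t in Set.uIoc s x, ‖2 * g t * g' t‖
          ≤ ∫ t in Set.Icc 0 (2 * Real.pi), ‖2 * g t * g' t‖ :=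
            setIntegral_mono_set (int (by fun_prop)) (ae_of_all _ fun _ => norm_nonneg _)
              hsub.eventuallyLE
        _ ≤ K := by
            refine integral_mono (int (by fun_prop)) (int (by fun_prop)) fun t => ?_
            rw [Real.norm_eq_abs]
            exact abs_le.2 ⟨by nlinarith [sq_nonneg (g t + g' t)],
              by nlinarith [sq_nonneg (g t - g' t)]⟩
    linarith
  have h3 : ∫ _ in Set.Icc 0 (2 * Real.pi), (g x) ^ 2 ≤
      ∫ s in Set.Icc 0 (2 * Real.pi), ((g s) ^ 2 + K) :=
    setIntegral_mono_on (int (by fun_prop)) (int (by fun_prop)) measurableSet_Icc step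
  rw [integral_add (int (by fun_prop)) (int (by fun_prop))] at h3
  have hpi : 0 ≤ 2 * Real.pi := by positivity
  simp only [setIntegral_const, smul_eq_mul, Real.volume_real_Icc_of_le hpi, sub_zero] at h3
  have h4 : ∫ s in Set.Icc 0 (2 * Real.pi), (2 * (g s) ^ 2 + (g' s) ^ 2) =
      (∫ s in Set.Icc 0 (2 * Real.pi), (g s) ^ 2) + K := by
    rw [hK, ← integral_add (int (by fun_prop)) (int (by fun_prop))]
    congr 1
    ext s
    ring
  have h5 : 0 ≤ ∫ s in Set.Icc 0 (2 * Real.pi), (g s) ^ 2 :=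
    integral_nonneg fun _ => sq_nonneg _
  rw [h4]
  have h6 : 1 ≤ 2 * Real.pi := by linarith [Real.two_le_pi]
  have h7 : 2 * Real.pi * (g x ^ 2) ≤
      2 * Real.pi * ((∫ s in Set.Icc 0 (2 * Real.pi), (g s) ^ 2) + K) := by
    nlinarith
  exact le_of_mul_le_mul_left h7 (by linarith)

/-- Ladyzhenskaya's inequality, in bilinear form. -/
theorem setIntegral_mul_sq_le (hv : SmoothPeriodic v) (hw : SmoothPeriodic w) :
    ∫ p in sq2, (v p * w p) ^ 2 ≤
      (2 * (∫ p in sq2, (v p) ^ 2) + ∫ p in sq2, (pdx v p) ^ 2) *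
      (2 * (∫ p in sq2, (w p) ^ 2) + ∫ p in sq2, (pdy w p) ^ 2) := by
  have cv := hv.continuous
  have cw := hw.continuous
  have cv' := hv.pdx.continuous
  have cw' := hw.pdy.continuous
  set F : ℝ → ℝ := fun y =>
    ∫ x in Set.Icc 0 (2 * Real.pi), (2 * (v (x, y)) ^ 2 + (pdx v (x, y)) ^ 2) with hF
  set G : ℝ → ℝ := fun x =>
    ∫ y in Set.Icc 0 (2 * Real.pi), (2 * (w (x, y)) ^ 2 + (pdy w (x, y)) ^ 2) with hG
  have cF : Continuous F :=
    continuous_parametric_integral_of_continuous (by fun_prop) isCompact_Icc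
  have cG : Continuous G :=
    continuous_parametric_integral_of_continuous (by fun_prop) isCompact_Icc
  have iF : ∫ y in Set.Icc 0 (2 * Real.pi), F y =
      2 * (∫ p in sq2, (v p) ^ 2) + ∫ p in sq2, (pdx v p) ^ 2 := by
    rw [hF, ← setIntegral_sq2_symm (u := fun p => 2 * (v p) ^ 2 + (pdx v p) ^ 2)
      (by fun_prop), integral_add (Continuous.integrableOn_sq2 (by fun_prop))
      (Continuous.integrableOn_sq2 (by fun_prop)), integral_const_mul]
  have iG : ∫ x in Set.Icc 0 (2 * Real.pi), G x =
      2 * (∫ p in sq2, (w p) ^ 2) + ∫ p in sq2, (pdy w p) ^ 2 := by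
    rw [hG, ← setIntegral_sq2 (u := fun p => 2 * (w p) ^ 2 + (pdy w p) ^ 2)
      (by fun_prop), integral_add (Continuous.integrableOn_sq2 (by fun_prop))
      (Continuous.integrableOn_sq2 (by fun_prop)), integral_const_mul]
  rw [← iF, ← iG, mul_comm]
  refine le_trans ?_ (setIntegral_prod_mul (μ := volume) (ν := volume) G F _ _).le
  refine setIntegral_mono_on (Continuous.integrableOn_sq2 (by fun_prop))
    (Continuous.integrableOn_sq2 (u := fun p => G p.1 * F p.2) (by fun_prop))
    isCompact_sq2.measurableSet ?_
  rintro ⟨x, y⟩ ⟨hx, hy⟩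
  have hvF : (v (x, y)) ^ 2 ≤ F y :=
    sq_le_setIntegral_Icc (fun x => hasDerivAt_fst hv x y) (by fun_prop) hx
  have hwG : (w (x, y)) ^ 2 ≤ G x :=
    sq_le_setIntegral_Icc (fun y => hasDerivAt_snd hw x y) (by fun_prop) hy
  calc (v (x, y) * w (x, y)) ^ 2 = (w (x, y)) ^ 2 * (v (x, y)) ^ 2 := by ring
    _ ≤ G x * F y := mul_le_mul hwG hvF (sq_nonneg _) ((sq_nonneg _).trans hwG)

/-- `u` is smooth periodic and all its iterated partial derivatives of order at most `k` have
`L²` norm at most `C`. -/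
def SobolevBound : ℕ → ℝ → (ℝ × ℝ → ℝ) → Prop
  | 0, C, u => SmoothPeriodic u ∧ l2norm u ≤ C
  | k + 1, C, u => (SmoothPeriodic u ∧ l2norm u ≤ C) ∧
      SobolevBound k C (pdx u) ∧ SobolevBound k C (pdy u)

namespace SobolevBound

variable {k : ℕ} {C D : ℝ}

theorem base (h : SobolevBound k C u) : SmoothPeriodic u ∧ l2norm u ≤ C := by
  cases k with
  | zero => exact h
  | succ k => exact h.1

theorem nonneg (h : SobolevBound k C u) : 0 ≤ C := (l2norm_nonneg u).trans h.base.2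

theorem mono (h : SobolevBound k C u) (hCD : C ≤ D) : SobolevBound k D u := by
  induction k generalizing u with
  | zero => exact ⟨h.1, h.2.trans hCD⟩
  | succ k ih => exact ⟨⟨h.1.1, h.1.2.trans hCD⟩, ih h.2.1, ih h.2.2⟩

theorem of_succ (h : SobolevBound (k + 1) C u) : SobolevBound k C u := by
  induction k generalizing u with
  | zero => exact h.1
  | succ k ih => exact ⟨h.1, ih h.2.1, ih h.2.2⟩

theorem add (hu : SobolevBound k C u) (hv : SobolevBound k D v) :
    SobolevBound k (2 * (C + D)) fun p => u p + v p := by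
  have hb : ∀ {u v : ℝ × ℝ → ℝ}, (SmoothPeriodic u ∧ l2norm u ≤ C) →
      (SmoothPeriodic v ∧ l2norm v ≤ D) →
      SmoothPeriodic (fun p => u p + v p) ∧ l2norm (fun p => u p + v p) ≤ 2 * (C + D) := by
    intro u v hu hv
    have cu := hu.1.continuous
    have cv := hv.1.continuous
    obtain ⟨hC, iu⟩ := l2norm_le_iff.1 hu.2
    obtain ⟨hD, iv⟩ := l2norm_le_iff.1 hv.2
    refine ⟨hu.1.add hv.1, l2norm_le_iff.2 ⟨by positivity, ?_⟩⟩
    calc ∫ p in sq2, (u p + v p) ^ 2 ≤ ∫ p in sq2, (2 * (u p) ^ 2 + 2 * (v p) ^ 2) :=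
          integral_mono (Continuous.integrableOn_sq2 (by fun_prop))
            (Continuous.integrableOn_sq2 (by fun_prop))
            fun p => by
              change (u p + v p) ^ 2 ≤ 2 * (u p) ^ 2 + 2 * (v p) ^ 2
              nlinarith [sq_nonneg (u p - v p)]
      _ = 2 * (∫ p in sq2, (u p) ^ 2) + 2 * ∫ p in sq2, (v p) ^ 2 := by
          rw [integral_add (Continuous.integrableOn_sq2 (by fun_prop))
            (Continuous.integrableOn_sq2 (by fun_prop)), integral_const_mul,
            integral_const_mul]
      _ ≤ (2 * (C + D)) ^ 2 := by nlinarith [mul_nonneg hC hD]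
  induction k generalizing u v with
  | zero => exact hb hu hv
  | succ k ih =>
    refine ⟨hb hu.1 hv.1, ?_, ?_⟩
    · rw [pdx_add hu.1.1 hv.1.1]
      exact ih hu.2.1 hv.2.1
    · rw [pdy_add hu.1.1 hv.1.1]
      exact ih hu.2.2 hv.2.2

theorem const_mul (hu : SobolevBound k C u) (a : ℝ) :
    SobolevBound k (|a| * C) fun p => a * u p := by
  have hb : ∀ {u : ℝ × ℝ → ℝ}, (SmoothPeriodic u ∧ l2norm u ≤ C) →
      SmoothPeriodic (fun p => a * u p) ∧ l2norm (fun p => a * u p) ≤ |a| * C := by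
    intro u hu
    obtain ⟨hC, iu⟩ := l2norm_le_iff.1 hu.2
    refine ⟨hu.1.const_mul a, l2norm_le_iff.2 ⟨by positivity, ?_⟩⟩
    simp only [mul_pow, integral_const_mul, sq_abs]
    exact mul_le_mul_of_nonneg_left iu (sq_nonneg a)
  induction k generalizing u with
  | zero => exact hb hu
  | succ k ih =>
    refine ⟨hb hu.1, ?_, ?_⟩
    · rw [pdx_const_mul hu.1.1]
      exact ih hu.2.1
    · rw [pdy_const_mul hu.1.1]
      exact ih hu.2.2

theorem l2norm_mul_le (hu : SobolevBound 1 C u) (hv : SobolevBound 1 D v) :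
    l2norm (fun p => u p * v p) ≤ 3 * (C * D) := by
  obtain ⟨hC, iu⟩ := l2norm_le_iff.1 hu.1.2
  obtain ⟨hD, iv⟩ := l2norm_le_iff.1 hv.1.2
  have iu' := (l2norm_le_iff.1 hu.2.1.2).2
  have iv' := (l2norm_le_iff.1 hv.2.2.2).2
  refine l2norm_le_iff.2 ⟨by positivity, (setIntegral_mul_sq_le hu.1.1 hv.1.1).trans ?_⟩
  have := setIntegral_sq2_nonneg v
  have := setIntegral_sq2_nonneg (pdy v)
  calc _ ≤ (3 * C ^ 2) * (3 * D ^ 2) :=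
        mul_le_mul (by linarith) (by linarith) (by positivity) (by positivity)
    _ = _ := by ring

/-- In two dimensions, multiplication maps `H^{k+1} × H^{k+1}` to `H^k`. -/
theorem mul (hu : SobolevBound (k + 1) C u) (hv : SobolevBound (k + 1) D v) :
    SobolevBound k (3 * 4 ^ k * (C * D)) fun p => u p * v p := by
  induction k generalizing u v with
  | zero =>
    refine ⟨hu.1.1.mul hv.1.1, (l2norm_mul_le hu hv).trans_eq (by ring)⟩
  | succ k ih =>
    have hCD : 0 ≤ C * D := mul_nonneg hu.nonneg hv.nonneg
    have heq : 2 * (3 * 4 ^ k * (C * D) + 3 * 4 ^ k * (C * D)) =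
        3 * 4 ^ (k + 1) * (C * D) := by ring
    refine ⟨⟨hu.1.1.mul hv.1.1, (ih hu.of_succ hv.of_succ).base.2.trans ?_⟩, ?_, ?_⟩
    · rw [pow_succ]
      nlinarith [mul_nonneg (pow_nonneg (by norm_num : (0 : ℝ) ≤ 4) k) hCD]
    · rw [pdx_mul hu.1.1 hv.1.1, ← heq]
      exact (ih hu.2.1 hv.of_succ).add (ih hu.of_succ hv.2.1)
    · rw [pdy_mul hu.1.1 hv.1.1, ← heq]
      exact (ih hu.2.2 hv.of_succ).add (ih hu.of_succ hv.2.2)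

/-- Elliptic regularity for `A`. -/
theorem of_Aop (hu : SmoothPeriodic u) (h : SobolevBound k C (Aop u)) :
    SobolevBound (k + 2) C u := by
  induction k generalizing u with
  | zero =>
    obtain ⟨hC, hA⟩ := l2norm_le_iff.1 h.2
    rw [setIntegral_Aop_sq hu] at hA
    have n0 := setIntegral_sq2_nonneg u
    have n1 := setIntegral_sq2_nonneg (pdx u)
    have n2 := setIntegral_sq2_nonneg (pdy u)
    have n3 := setIntegral_sq2_nonneg (pdx (pdx u))
    have n4 := setIntegral_sq2_nonneg (pdy (pdx u))
    have n5 := setIntegral_sq2_nonneg (pdy (pdy u))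
    refine ⟨⟨hu, l2norm_le_iff.2 ⟨hC, by linarith⟩⟩,
      ⟨⟨hu.pdx, l2norm_le_iff.2 ⟨hC, by linarith⟩⟩,
        ⟨hu.pdx.pdx, l2norm_le_iff.2 ⟨hC, by linarith⟩⟩,
        ⟨hu.pdx.pdy, l2norm_le_iff.2 ⟨hC, by linarith⟩⟩⟩,
      ⟨⟨hu.pdy, l2norm_le_iff.2 ⟨hC, by linarith⟩⟩,
        ⟨hu.pdy.pdx, l2norm_le_iff.2 ⟨hC, ?_⟩⟩,
        ⟨hu.pdy.pdy, l2norm_le_iff.2 ⟨hC, by linarith⟩⟩⟩⟩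
    rw [pdx_pdy_comm hu]
    linarith
  | succ k ih =>
    have hx := h.2.1
    have hy := h.2.2
    rw [pdx_Aop hu] at hx
    rw [pdy_Aop hu] at hy
    exact ⟨(ih hu h.of_succ).base, ih hu.pdx hx, ih hu.pdy hy⟩

theorem of_iterate_Aop (m : ℕ) (hu : SmoothPeriodic u) :
    SobolevBound (2 * m) (l2norm (Aop^[m] u)) u := by
  induction m generalizing u with
  | zero => exact ⟨hu, le_rfl⟩
  | succ m ih => exact of_Aop hu (ih hu.Aop)

theorem Aop (h : SobolevBound (k + 2) C u) : SobolevBound k (10 * C) (Aop u) := by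
  have e : _root_.Aop u = fun p => -1 * (pdx (pdx u) p + pdy (pdy u) p) + u p := by
    ext p
    simp [_root_.Aop]
  rw [e]
  refine (((h.2.1.2.1.add h.2.2.2.2).const_mul (-1)).add h.of_succ.of_succ).mono ?_
  simp only [abs_neg, abs_one]
  linarith

theorem iterate_Aop (m : ℕ) (h : SobolevBound (2 * m) C u) :
    l2norm (_root_.Aop^[m] u) ≤ 10 ^ m * C := by
  induction m generalizing u C with
  | zero => simpa using h.2
  | succ m ih => exact (ih (Aop h)).trans_eq (by ring)

end SobolevBound

theorem exists_sobolevBound_fNL (a b : ℝ) (k : ℕ) :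
    ∃ c > 0, ∀ (N : ℝ) (u : ℝ × ℝ → ℝ), SobolevBound (k + 2) N u →
      SobolevBound k (c * (N + N ^ 2 + N ^ 3)) (fNL a b u) := by
  set K : ℝ := 3 * 4 ^ k
  set L : ℝ := 3 * 4 ^ (k + 1)
  refine ⟨8 * (|a + 3| + 40) + 16 * |b| * K + 2 * (K * L) + 1, by positivity, ?_⟩
  intro N u hu
  have hN := hu.nonneg
  have e : fNL a b u = fun p => (((a + 3) * u p + (-4) * Aop u p) +
      b * (pdx u p * pdx u p + pdy u p * pdy u p)) + (u p * u p) * u p := by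
    ext p
    simp only [fNL, gradDot]
    ring
  rw [e]
  have hlin := (hu.of_succ.of_succ.const_mul (a + 3)).add (hu.Aop.const_mul (-4))
  have hgrad := ((hu.2.1.mul hu.2.1).add (hu.2.2.mul hu.2.2)).const_mul b
  have hcube := (hu.mul hu).mul hu.of_succ
  refine ((hlin.add hgrad).add hcube).mono ?_
  have h4 : |(-4 : ℝ)| = 4 := by norm_num
  rw [h4]
  have hid : 2 * (2 * (2 * (|a + 3| * N + 4 * (10 * N)) +
      |b| * (2 * (K * (N * N) + K * (N * N)))) + K * (L * (N * N) * N)) =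
      (8 * (|a + 3| + 40)) * N + (16 * |b| * K) * N ^ 2 + (2 * (K * L)) * N ^ 3 := by
    ring
  refine hid.le.trans ?_
  have p1 : 0 ≤ 8 * (|a + 3| + 40) := by positivity
  have p2 : 0 ≤ 16 * |b| * K := by positivity
  have p3 : 0 ≤ 2 * (K * L) := by positivity
  have q2 : 0 ≤ N ^ 2 := by positivity
  have q3 : 0 ≤ N ^ 3 := by positivity
  generalize 8 * (|a + 3| + 40) = α at *
  generalize 16 * |b| * K = β at *
  generalize 2 * (K * L) = γ at *
  nlinarith [mul_nonneg p1 q2, mul_nonneg p1 q3, mul_nonneg p2 hN, mul_nonneg p2 q3,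
    mul_nonneg p3 hN, mul_nonneg p3 q2]

end

/-- Estimate for `‖A^{m−1} f(u)‖`. -/
theorem stmt_9 (a b : ℝ) (m : ℕ) (hm : 1 ≤ m) :
    ∃ c > 0, ∀ u : ℝ × ℝ → ℝ, SmoothPeriodic u →
      l2norm (Aop^[m - 1] (fNL a b u)) ≤
        c * (l2norm (Aop^[m] u) + l2norm (Aop^[m] u) ^ 2 + l2norm (Aop^[m] u) ^ 3) := by
  obtain ⟨n, rfl⟩ : ∃ n, m = n + 1 := ⟨m - 1, by omega⟩
  obtain ⟨c, hc, h⟩ := exists_sobolevBound_fNL a b (2 * n)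
  refine ⟨10 ^ n * c, by positivity, fun u hu => ?_⟩
  have hf := h _ u (SobolevBound.of_iterate_Aop (n + 1) hu)
  exact (SobolevBound.iterate_Aop n hf).trans_eq (by ring)
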